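/- (Completeness of M-hyperquasi-equational logic.) Let M be a submonoid of the monoid H(τ) of hypersubstitutions of type τ. For every set Σ of quasi-identities of type τ and every quasi-identity e of type τ: e is an M-hyperconsequence of Σ if and only if e is derivable from Σ in the calculus MHQ. In symbols: Σ ⊨_HQ^M e if and only if Σ ⊢_HQ^M e. -/

import Mathlib

open scoped Classical

/-- Terms of a type `τ = (I, ar)`: an indexed family of operation symbols `I`
with arities `ar`, over countably many variables. -/
inductive Trm (I : Type) (ar : I → ℕ) : Type
  | var : ℕ → Trm I ar
  | app (f : I) : (Fin (ar f) → Trm I ar) → Trm I ar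

variable {I : Type} {ar : I → ℕ}

/-- Simultaneous substitution of terms for variables. -/
def Trm.subst (δ : ℕ → Trm I ar) : Trm I ar → Trm I ar
  | .var n => δ n
  | .app f ts => .app f fun i => (ts i).subst δ

/-- A hypersubstitution assigns to each operation symbol `f` a term `σ(f)`. -/
def Hyp (I : Type) (ar : I → ℕ) := (f : I) → Trm I ar

/-- The extension of a hypersubstitution to all terms. -/
def Hyp.apply (σ : Hyp I ar) : Trm I ar → Trm I ar
  | .var n => .var n
  | .app f ts => (σ f).subst fun n => if h : n < ar f then σ.apply (ts ⟨n, h⟩) else .var n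

/-- The identity hypersubstitution `σ_id`. -/
def Hyp.id (I : Type) (ar : I → ℕ) : Hyp I ar := fun f => .app f fun i => .var i

/-- Composition of hypersubstitutions: `(σ₁ ∘ σ₂)(f) = σ₁(σ₂(f))`. -/
def Hyp.comp (σ₁ σ₂ : Hyp I ar) : Hyp I ar := fun f => σ₁.apply (σ₂ f)

/-- Occurrence of the variable `m` in a term. -/
inductive Occurs (m : ℕ) : Trm I ar → Prop
  | var : Occurs m (.var m)
  | app {f ts} (i : Fin (ar f)) : Occurs m (ts i) → Occurs m (.app f ts)

/-- `σ` is a genuine hypersubstitution: `σ(f)` is an `(ar f)`-ary term,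
i.e. its variables are among `x₀, …, x_{ar f - 1}`.  The set `{σ | IsHyp σ}`
plays the role of the monoid `H(τ)` of all hypersubstitutions of type `τ`. -/
def IsHyp (σ : Hyp I ar) : Prop := ∀ f m, Occurs m (σ f) → m < ar f

/-- An identity `t ≈ s` of type `τ`. -/
abbrev Eqn (I : Type) (ar : I → ℕ) := Trm I ar × Trm I ar

/-- A quasi-identity `Δ → α` of type `τ`: a finite set `Δ` of identities
(the premises) together with an identity `α` (the conclusion). -/
abbrev Quasi (I : Type) (ar : I → ℕ) := Finset (Eqn I ar) × Eqn I ar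

/-- Applying a map on terms to every term occurring in a quasi-identity. -/
noncomputable def mapQ (g : Trm I ar → Trm I ar) (q : Quasi I ar) : Quasi I ar :=
  (q.1.image fun p => (g p.1, g p.2), (g q.2.1, g q.2.2))

/-- An algebra of type `τ`. -/
structure Alg (I : Type) (ar : I → ℕ) where
  carrier : Type
  ops : (f : I) → (Fin (ar f) → carrier) → carrier

/-- Evaluation of a term in an algebra under an assignment `v`. -/
def Alg.eval (A : Alg I ar) (v : ℕ → A.carrier) : Trm I ar → A.carrier
  | .var n => v n
  | .app f ts => A.ops f fun i => A.eval v (ts i)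

/-- Satisfaction of a quasi-identity in an algebra: every assignment making all
premises hold makes the conclusion hold. -/
def Alg.Sat (A : Alg I ar) (q : Quasi I ar) : Prop :=
  ∀ v : ℕ → A.carrier,
    (∀ p ∈ q.1, A.eval v p.1 = A.eval v p.2) → A.eval v q.2.1 = A.eval v q.2.2

/-- `M`-hypersatisfaction of a quasi-identity in an algebra: `A` satisfies
`σ(q)` for every hypersubstitution `σ ∈ M`. -/
def Alg.HypSatM (A : Alg I ar) (M : Set (Hyp I ar)) (q : Quasi I ar) : Prop :=
  ∀ σ ∈ M, A.Sat (mapQ (Hyp.apply σ) q)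

/-- The quasi-equational calculus `Q` (when `M = ∅`), resp. its extension by the
hypersubstitution rule for the hypersubstitutions of `M`: `MHQ` for a submonoid
`M ⊆ H(τ)`, and `HQ` when `M = {σ | IsHyp σ} = H(τ)`. -/
inductive Der (M : Set (Hyp I ar)) (S : Set (Quasi I ar)) : Quasi I ar → Prop
  | hyp {q} : q ∈ S → Der M S q
  | refl (p : Trm I ar) : Der M S (∅, (p, p))
  | assm (α : Eqn I ar) : Der M S ({α}, α)
  | symm (p q : Trm I ar) : Der M S ({(p, q)}, (q, p))
  | trans (p q r : Trm I ar) : Der M S ({(p, q), (q, r)}, (p, r))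
  | compat (f : I) (t s : Fin (ar f) → Trm I ar) :
      Der M S (Finset.univ.image fun i => (t i, s i), (.app f t, .app f s))
  | subst {q} (δ : ℕ → Trm I ar) : Der M S q → Der M S (mapQ (Trm.subst δ) q)
  | hypsub {q} {σ : Hyp I ar} : σ ∈ M → Der M S q → Der M S (mapQ (Hyp.apply σ) q)
  | cut {Δ Γ : Finset (Eqn I ar)} {α β : Eqn I ar} :
      Der M S (Δ, α) → Der M S (insert α Γ, β) → Der M S (Δ ∪ Γ, β)
  | ext {Δ : Finset (Eqn I ar)} {α : Eqn I ar} (β : Eqn I ar) :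
      Der M S (Δ, α) → Der M S (insert β Δ, α)

theorem Trm.subst_congr {δ ε : ℕ → Trm I ar} (t : Trm I ar)
    (h : ∀ m, Occurs m t → δ m = ε m) : t.subst δ = t.subst ε := by
  induction t with
  | var n => exact h n .var
  | app f ts ih =>
    simp only [Trm.subst]
    congr 1
    funext i
    exact ih i fun m hm => h m (.app i hm)

theorem Trm.subst_subst (δ ε : ℕ → Trm I ar) (t : Trm I ar) :
    (t.subst δ).subst ε = t.subst fun n => (δ n).subst ε := by
  induction t with
  | var n => rfl
  | app f ts ih => simp only [Trm.subst, ih]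

theorem Trm.subst_var (t : Trm I ar) : t.subst Trm.var = t := by
  induction t with
  | var n => rfl
  | app f ts ih => simp only [Trm.subst, ih]

theorem Hyp.apply_subst {σ : Hyp I ar} (hσ : IsHyp σ) (δ : ℕ → Trm I ar) (t : Trm I ar) :
    σ.apply (t.subst δ) = (σ.apply t).subst fun n => σ.apply (δ n) := by
  induction t with
  | var n => rfl
  | app f ts ih =>
    simp only [Trm.subst, Hyp.apply, Trm.subst_subst]
    refine Trm.subst_congr _ fun m hm => ?_
    simp only [hσ f m hm, dif_pos, ih]

theorem Hyp.apply_comp {σ₁ : Hyp I ar} (h₁ : IsHyp σ₁) (σ₂ : Hyp I ar) (t : Trm I ar) :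
    (Hyp.comp σ₁ σ₂).apply t = σ₁.apply (σ₂.apply t) := by
  induction t with
  | var n => rfl
  | app f ts ih =>
    simp only [Hyp.apply, Hyp.comp] at ih ⊢
    rw [Hyp.apply_subst h₁]
    congr 1
    funext n
    split_ifs with h
    · exact ih ⟨n, h⟩
    · rfl

theorem Hyp.apply_id (t : Trm I ar) : (Hyp.id I ar).apply t = t := by
  induction t with
  | var n => rfl
  | app f ts ih => simp [Hyp.apply, Hyp.id, Trm.subst, ih]

theorem Alg.eval_subst (A : Alg I ar) (v : ℕ → A.carrier) (δ : ℕ → Trm I ar) (t : Trm I ar) :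
    A.eval v (t.subst δ) = A.eval (fun n => A.eval v (δ n)) t := by
  induction t with
  | var n => rfl
  | app f ts ih => simp only [Trm.subst, Alg.eval, ih]

theorem Alg.sat_mapQ (A : Alg I ar) (g : Trm I ar → Trm I ar) (q : Quasi I ar) :
    A.Sat (mapQ g q) ↔ ∀ v : ℕ → A.carrier,
      (∀ p ∈ q.1, A.eval v (g p.1) = A.eval v (g p.2)) →
        A.eval v (g q.2.1) = A.eval v (g q.2.2) := by
  simp only [Alg.Sat, mapQ, Finset.forall_mem_image]

theorem Alg.hypSatM_of_der {M : Set (Hyp I ar)} (hM : ∀ σ ∈ M, IsHyp σ)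
    (hcomp : ∀ σ₁ ∈ M, ∀ σ₂ ∈ M, Hyp.comp σ₁ σ₂ ∈ M) {S : Set (Quasi I ar)}
    (A : Alg I ar) (hA : ∀ q ∈ S, A.HypSatM M q) {e : Quasi I ar} (h : Der M S e) :
    A.HypSatM M e := by
  induction h with
  | hyp hq => exact hA _ hq
  | refl p =>
    intro σ _
    rw [Alg.sat_mapQ]
    intro v _
    rfl
  | assm α =>
    intro σ _
    rw [Alg.sat_mapQ]
    intro v hv
    exact hv α (by simp)
  | symm p q =>
    intro σ _
    rw [Alg.sat_mapQ]
    intro v hv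
    exact (hv (p, q) (by simp)).symm
  | trans p q r =>
    intro σ _
    rw [Alg.sat_mapQ]
    intro v hv
    exact (hv (p, q) (by simp)).trans (hv (q, r) (by simp))
  | compat f t s =>
    intro σ _
    rw [Alg.sat_mapQ]
    intro v hv
    simp only [Hyp.apply, Alg.eval_subst]
    congr 1
    funext n
    split_ifs with h
    · exact hv (t ⟨n, h⟩, s ⟨n, h⟩) (Finset.mem_image_of_mem _ (Finset.mem_univ _))
    · rfl
  | @subst q δ _ ih =>
    intro σ hσ
    have hq := (A.sat_mapQ _ _).1 (ih σ hσ)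
    rw [Alg.sat_mapQ]
    intro v hv
    simp only [mapQ, Finset.forall_mem_image, Hyp.apply_subst (hM σ hσ), Alg.eval_subst] at hv ⊢
    exact hq _ hv
  | @hypsub q σ' hσ' _ ih =>
    intro σ hσ
    have hq := (A.sat_mapQ _ _).1 (ih _ (hcomp σ hσ σ' hσ'))
    rw [Alg.sat_mapQ]
    intro v hv
    simp only [mapQ, Finset.forall_mem_image, ← Hyp.apply_comp (hM σ hσ)] at hv ⊢
    exact hq v hv
  | @cut Δ Γ α β _ _ ih₁ ih₂ =>
    intro σ hσ
    rw [Alg.sat_mapQ]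
    intro v hv
    refine (A.sat_mapQ _ _).1 (ih₂ σ hσ) v fun p hp => ?_
    rcases Finset.mem_insert.1 hp with rfl | hp
    · exact (A.sat_mapQ _ _).1 (ih₁ σ hσ) v fun p hp => hv p (Finset.mem_union_left _ hp)
    · exact hv p (Finset.mem_union_right _ hp)
  | @ext Δ α β _ ih =>
    intro σ hσ
    rw [Alg.sat_mapQ]
    intro v hv
    exact (A.sat_mapQ _ _).1 (ih σ hσ) v fun p hp => hv p (Finset.mem_insert_of_mem hp)

section Deducibility

variable {M : Set (Hyp I ar)} {S : Set (Quasi I ar)}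

theorem Der.union_left {Δ : Finset (Eqn I ar)} {α : Eqn I ar} (Γ : Finset (Eqn I ar))
    (h : Der M S (Δ, α)) : Der M S (Γ ∪ Δ, α) := by
  induction Γ using Finset.induction_on with
  | empty => rwa [Finset.empty_union]
  | insert a Γ _ ih =>
    rw [Finset.insert_union]
    exact ih.ext a

theorem Der.of_mem {Δ : Finset (Eqn I ar)} {α : Eqn I ar} (h : α ∈ Δ) : Der M S (Δ, α) := by
  have := (Der.assm (M := M) (S := S) α).union_left Δ
  rwa [Finset.union_eq_left.2 (Finset.singleton_subset_iff.2 h)] at this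

theorem Der.cut_finset {Δ Γ : Finset (Eqn I ar)} {β : Eqn I ar}
    (hΓ : ∀ p ∈ Γ, Der M S (Δ, p)) (h : Der M S (Γ, β)) : Der M S (Δ, β) := by
  have key : Der M S (Γ ∪ Δ, β) → Der M S (Δ, β) := by
    clear h
    induction Γ using Finset.induction_on with
    | empty => rw [Finset.empty_union]; exact fun h => h
    | insert a Γ _ ih =>
      intro h
      rw [Finset.insert_union] at h
      refine ih (fun p hp => hΓ p (Finset.mem_insert_of_mem hp)) ?_
      have := (hΓ a (Finset.mem_insert_self _ _)).cut h
      rwa [Finset.union_eq_right.2 Finset.subset_union_right] at this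
  refine key ?_
  rw [Finset.union_comm]
  exact h.union_left Δ

end Deducibility

/-- Two terms are related when their equality is derivable from the premises `Δ`. -/
def derSetoid (M : Set (Hyp I ar)) (S : Set (Quasi I ar)) (Δ : Finset (Eqn I ar)) :
    Setoid (Trm I ar) where
  r p q := Der M S (Δ, (p, q))
  iseqv :=
    { refl := fun p => (Der.refl p).cut_finset (by simp)
      symm := fun {p q} h => (Der.symm p q).cut_finset (by simpa using h)
      trans := fun {p q r} h₁ h₂ => (Der.trans p q r).cut_finset (by
        intro x hx
        simp only [Finset.mem_insert, Finset.mem_singleton] at hx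
        rcases hx with rfl | rfl
        exacts [h₁, h₂]) }

/-- The term algebra modulo the equations derivable from the premises `Δ`. -/
noncomputable def derAlg (M : Set (Hyp I ar)) (S : Set (Quasi I ar)) (Δ : Finset (Eqn I ar)) :
    Alg I ar where
  carrier := Quotient (derSetoid M S Δ)
  ops f ts := Quotient.mk _ (.app f fun i => (ts i).out)

theorem derAlg_eval (M : Set (Hyp I ar)) (S : Set (Quasi I ar)) (Δ : Finset (Eqn I ar))
    (δ : ℕ → Trm I ar) (t : Trm I ar) :
    (derAlg M S Δ).eval (fun n => Quotient.mk (derSetoid M S Δ) (δ n)) t =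
      Quotient.mk (derSetoid M S Δ) (t.subst δ) := by
  induction t with
  | var n => rfl
  | app f ts ih =>
    simp only [Alg.eval, Trm.subst, ih]
    refine Quotient.sound (s := derSetoid M S Δ) ((Der.compat f _ _).cut_finset ?_)
    simp only [Finset.forall_mem_image]
    intro i _
    exact Quotient.mk_out (s := derSetoid M S Δ) _

theorem derAlg_eval_eq_iff (M : Set (Hyp I ar)) (S : Set (Quasi I ar)) (Δ : Finset (Eqn I ar))
    (δ : ℕ → Trm I ar) (t s : Trm I ar) :
    (derAlg M S Δ).eval (fun n => Quotient.mk (derSetoid M S Δ) (δ n)) t =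
        (derAlg M S Δ).eval (fun n => Quotient.mk (derSetoid M S Δ) (δ n)) s ↔
      Der M S (Δ, (t.subst δ, s.subst δ)) := by
  rw [derAlg_eval, derAlg_eval]
  exact Quotient.eq (r := derSetoid M S Δ)

theorem derAlg_sat_of_der {M : Set (Hyp I ar)} {S : Set (Quasi I ar)} (Δ : Finset (Eqn I ar))
    {q : Quasi I ar} (h : Der M S q) : (derAlg M S Δ).Sat q := by
  intro v hv
  obtain ⟨δ, rfl⟩ : ∃ δ : ℕ → Trm I ar, v = fun n => Quotient.mk (derSetoid M S Δ) (δ n) :=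
    ⟨fun n => Quotient.out (v n), funext fun n => (Quotient.out_eq (v n)).symm⟩
  simp only [derAlg_eval_eq_iff] at hv ⊢
  refine (h.subst δ).cut_finset ?_
  simpa only [mapQ, Finset.forall_mem_image] using hv

/-- Completeness of `M`-hyperquasi-equational logic: let `M` be a submonoid of
`H(τ)`.  A quasi-identity `e` is an `M`-hyperconsequence of a set `Σ` of
quasi-identities (every algebra of type `τ` that `M`-hypersatisfies every member
of `Σ` `M`-hypersatisfies `e`) if and only if `e` is derivable from `Σ` in the
calculus `MHQ`:  `Σ ⊨_HQ^M e ↔ Σ ⊢_HQ^M e`. -/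
theorem completeness_MHQ (M : Set (Hyp I ar))
    (hM : ∀ σ ∈ M, IsHyp σ) (hid : Hyp.id I ar ∈ M)
    (hcomp : ∀ σ₁ ∈ M, ∀ σ₂ ∈ M, Hyp.comp σ₁ σ₂ ∈ M)
    (S : Set (Quasi I ar)) (e : Quasi I ar) :
    (∀ A : Alg I ar, (∀ q ∈ S, A.HypSatM M q) → A.HypSatM M e) ↔ Der M S e := by
  constructor
  · intro h
    have hsat := h (derAlg M S e.1) fun q hq σ hσ => derAlg_sat_of_der e.1 ((Der.hyp hq).hypsub hσ)
    have key := (Alg.sat_mapQ _ _ _).1 (hsat _ hid)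
      fun n => Quotient.mk (derSetoid M S e.1) (Trm.var n)
    simp only [Hyp.apply_id, derAlg_eval_eq_iff, Trm.subst_var] at key
    exact key fun p hp => Der.of_mem hp
  · exact fun h A hA => A.hypSatM_of_der hM hcomp hA h
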